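/- arXiv:1308.4091 — 5 statements merged into one kernel-verified Lean document; each statement's English description precedes it below -/
import Mathlib

section
/- Let m ≥ 1, let 0 < σ_1 < σ_2 < … < σ_m be real numbers, and let b_1, …, b_m be positive reals with b_1 + … + b_m < 1. Then the equation 1 + Σ_{j=1}^m σ_j b_j / ((1 − Σ_{i=1}^m b_i)(σ_j − λ)) = 0, considered for λ ∈ ℂ \ {σ_1, …, σ_m}, has exactly m solutions; all of them are real, and when written in increasing order as μ_1 < μ_2 < … < μ_m they interlace with the σ_j, i.e. σ_j < μ_j < σ_{j+1} for j = 1, …, m−1 and σ_m < μ_m. -/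
open Polynomial in
/-- The secular equation `1 + ∑ j, c j / (s j - z) = 0` has at most as many solutions
as it has poles. -/
theorem card_le_of_secular_eq_zero {K ι : Type*} [Field K] [Fintype ι] (s c : ι → K)
    (T : Finset K) (hT : ∀ z ∈ T, (∀ j, z ≠ s j) ∧ 1 + ∑ j, c j / (s j - z) = 0) :
    T.card ≤ Fintype.card ι := by
  classical
  set P : K[X] := ∏ i, (X - C (s i)) with hP
  set R : K[X] := ∑ j, C (c j) * ∏ i ∈ Finset.univ.erase j, (X - C (s i)) with hR
  have hPm : P.Monic := monic_prod_of_monic _ _ fun i _ => monic_X_sub_C _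
  have hPd : P.degree = (Fintype.card ι : ℕ) := by
    rw [hP, degree_prod]
    simp
  have hRd : R.degree < P.degree := by
    rw [hPd]
    refine (degree_sum_le _ _).trans_lt ?_
    rw [Finset.sup_lt_iff (WithBot.bot_lt_coe _)]
    intro j _
    refine (degree_mul_le _ _).trans_lt ?_
    refine (add_le_add_left degree_C_le _).trans_lt ?_
    rw [degree_prod, zero_add]
    simp only [degree_X_sub_C, Finset.sum_const, nsmul_eq_mul, mul_one]
    exact_mod_cast Finset.card_erase_lt_of_mem (Finset.mem_univ j)
  have hQm : (P - R).Monic := hPm.sub_of_left hRd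
  have hQd : (P - R).natDegree = Fintype.card ι :=
    natDegree_eq_of_degree_eq_some ((degree_sub_eq_left_of_degree_lt hRd).trans hPd)
  rw [← hQd]
  refine card_le_degree_of_subset_roots fun z hz => ?_
  obtain ⟨hne, h0⟩ := hT z hz
  rw [mem_roots hQm.ne_zero, IsRoot.def]
  have key : (P - R).eval z = (∏ i, (z - s i)) * (1 + ∑ j, c j / (s j - z)) := by
    simp only [hP, hR, eval_sub, eval_prod, eval_finsetSum, eval_mul, eval_C, eval_X]
    rw [mul_add, mul_one, Finset.mul_sum, sub_eq_add_neg, ← Finset.sum_neg_distrib]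
    congr 1
    refine Finset.sum_congr rfl fun j _ => ?_
    have h : s j - z ≠ 0 := sub_ne_zero.2 (hne j).symm
    rw [← Finset.mul_prod_erase _ _ (Finset.mem_univ j)]
    field_simp
    ring
  rw [key, h0, mul_zero]

open Filter Topology in
/-- For positive weights, the secular function tends to `-∞` to the right of each pole. -/
theorem tendsto_secular_nhdsGT {ι : Type*} [Fintype ι] {s c : ι → ℝ}
    (hs : Function.Injective s) (j : ι) (hc : 0 < c j) :
    Tendsto (fun x => 1 + ∑ i, c i / (s i - x)) (𝓝[>] s j) atBot := by
  classical
  have hg : Tendsto (fun x => 1 + ∑ i ∈ Finset.univ.erase j, c i / (s i - x)) (𝓝[>] s j)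
      (𝓝 (1 + ∑ i ∈ Finset.univ.erase j, c i / (s i - s j))) := by
    refine Tendsto.mono_left ?_ nhdsWithin_le_nhds
    refine tendsto_const_nhds.add (tendsto_finsetSum _ fun i hi => ?_)
    exact tendsto_const_nhds.div (tendsto_const_nhds.sub tendsto_id)
      (sub_ne_zero.2 (hs.ne (Finset.ne_of_mem_erase hi)))
  have hp : Tendsto (fun x => c j / (s j - x)) (𝓝[>] s j) atBot := by
    have h : Tendsto (fun x => s j - x) (𝓝[>] s j) (𝓝[<] 0) := by
      refine tendsto_nhdsWithin_iff.2 ⟨?_, ?_⟩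
      · refine Tendsto.mono_left ?_ nhdsWithin_le_nhds
        exact (continuous_const.sub continuous_id).tendsto' _ _ (sub_self _)
      · filter_upwards [self_mem_nhdsWithin] with x hx using sub_neg.2 (Set.mem_Ioi.1 hx)
    simpa only [div_eq_mul_inv, Function.comp_def] using
      (tendsto_inv_nhdsLT_zero.comp h).const_mul_atBot hc
  refine (hp.atBot_add hg).congr fun x => ?_
  rw [← Finset.add_sum_erase _ _ (Finset.mem_univ j)]
  ring

open Filter Topology in
/-- For positive weights, the secular function tends to `+∞` to the left of each pole. -/
theorem tendsto_secular_nhdsLT {ι : Type*} [Fintype ι] {s c : ι → ℝ}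
    (hs : Function.Injective s) (j : ι) (hc : 0 < c j) :
    Tendsto (fun x => 1 + ∑ i, c i / (s i - x)) (𝓝[<] s j) atTop := by
  have h : Tendsto (fun x : ℝ => -x) (𝓝[<] s j) (𝓝[>] (-s j)) := tendsto_neg_nhdsLT
  have h' := (tendsto_const_nhds (x := (2 : ℝ))).add_atTop (tendsto_neg_atBot_atTop.comp
    ((tendsto_secular_nhdsGT (s := fun i => -s i) (neg_injective.comp hs) j hc).comp h))
  refine h'.congr fun x => ?_
  have e (i : ι) : c i / (-s i - -x) = -(c i / (s i - x)) := by
    rw [← div_neg]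
    ring
  simp only [Function.comp_apply, e, Finset.sum_neg_distrib]
  ring

open Filter Topology in
/-- For positive weights and increasing poles, the secular equation has a solution to the right
of each pole and to the left of all larger poles. -/
theorem exists_secular_eq_zero {m : ℕ} {s c : Fin m → ℝ} (hs : StrictMono s)
    (hc : ∀ j, 0 < c j) (j : Fin m) :
    ∃ x, s j < x ∧ (∀ i, j < i → x < s i) ∧ 1 + ∑ i, c i / (s i - x) = 0 := by
  set f : ℝ → ℝ := fun x => 1 + ∑ i, c i / (s i - x) with hf
  set S : Set ℝ := Set.Ioi (s j) ∩ ⋂ i, ⋂ _ : j < i, Set.Iio (s i) with hS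
  have mem_S (x : ℝ) : x ∈ S ↔ s j < x ∧ ∀ i, j < i → x < s i := by simp [hS]
  have hSc : IsPreconnected S :=
    (Set.ordConnected_Ioi.inter (Set.ordConnected_iInter fun i =>
      Set.ordConnected_iInter fun _ => Set.ordConnected_Iio)).isPreconnected
  have hfc : ContinuousOn f S := by
    refine continuousOn_const.add (continuousOn_finsetSum _ fun i _ => ?_)
    refine continuousOn_const.div (continuousOn_const.sub continuousOn_id) fun x hx => ?_
    rw [mem_S] at hx
    rcases lt_or_ge j i with h | h
    · exact (sub_pos.2 (hx.2 i h)).ne'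
    · exact (sub_neg.2 ((hs.monotone h).trans_lt hx.1)).ne
  obtain ⟨a, haS, ha⟩ : ∃ a ∈ S, f a < 0 := by
    have h1 : ∀ᶠ x in 𝓝[>] s j, ∀ i, j < i → x < s i :=
      eventually_all.2 fun i => by
        by_cases h : j < i
        · filter_upwards [nhdsWithin_le_nhds (Iio_mem_nhds (hs h))] with x hx _ using hx
        · simp [h]
    obtain ⟨x, hx, hx', hx0⟩ := (eventually_mem_nhdsWithin.and (h1.and
      ((tendsto_secular_nhdsGT hs.injective j (hc j)).eventually (eventually_lt_atBot 0)))).exists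
    exact ⟨x, (mem_S x).2 ⟨hx, hx'⟩, hx0⟩
  obtain ⟨b, hbS, hb⟩ : ∃ b ∈ S, 0 < f b := by
    by_cases h : (j : ℕ) + 1 < m
    · set k : Fin m := ⟨j + 1, h⟩ with hk
      have hjk : j < k := Fin.lt_def.2 (Nat.lt_succ_self _)
      obtain ⟨x, hx, hx', hx0⟩ := (eventually_mem_nhdsWithin.and
        ((eventually_nhdsWithin_of_eventually_nhds (lt_mem_nhds (hs hjk))).and
        ((tendsto_secular_nhdsLT hs.injective k (hc k)).eventually
          (eventually_gt_atTop 0)))).exists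
      exact ⟨x, (mem_S x).2 ⟨hx', fun i hi => lt_of_lt_of_le hx (hs.monotone hi)⟩, hx0⟩
    · have hlim : Tendsto f atTop (𝓝 1) := by
        have h0 : Tendsto f atTop (𝓝 (1 + ∑ _i : Fin m, 0)) := by
          refine tendsto_const_nhds.add (tendsto_finsetSum _ fun i _ => ?_)
          refine tendsto_const_nhds.div_atBot ?_
          exact (tendsto_atBot_add_const_left atTop (s i) tendsto_neg_atTop_atBot).congr
            fun x => (sub_eq_add_neg _ x).symm
        simpa using h0
      obtain ⟨x, hx, hx0⟩ := ((eventually_gt_atTop (s j)).and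
        (hlim.eventually (lt_mem_nhds one_pos))).exists
      exact ⟨x, (mem_S x).2 ⟨hx, fun i hi => by omega⟩, hx0⟩
  obtain ⟨x, hxS, hx⟩ := hSc.intermediate_value haS hbS hfc ⟨ha.le, hb.le⟩
  exact ⟨x, ((mem_S x).1 hxS).1, ((mem_S x).1 hxS).2, hx⟩


/-- For `m ≥ 1`, `0 < σ 0 < … < σ (m-1)` and positive `b j` with
`∑ b j < 1`, the equation `1 + ∑ j, σ j * b j / ((1 - ∑ i, b i) * (σ j - λ)) = 0`,
considered for `λ ∈ ℂ` avoiding the `σ j`, has exactly `m` solutions; all are real,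
and written in increasing order `μ 0 < … < μ (m-1)` they interlace with the `σ j`. -/
theorem spectral_gap_equation_roots
    (m : ℕ) (hm : 1 ≤ m) (σ b : Fin m → ℝ)
    (hσpos : ∀ j, 0 < σ j) (hσmono : StrictMono σ)
    (hbpos : ∀ j, 0 < b j) (hbsum : ∑ j, b j < 1) :
    ∃ μ : Fin m → ℝ, StrictMono μ ∧
      (∀ j, σ j < μ j) ∧
      (∀ j : Fin m, ∀ h : (j : ℕ) + 1 < m, μ j < σ ⟨(j : ℕ) + 1, h⟩) ∧
      (∀ z : ℂ, (∀ j, z ≠ (σ j : ℂ)) →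
        (1 + ∑ j, (σ j : ℂ) * (b j : ℂ) /
            ((1 - ∑ i, (b i : ℂ)) * ((σ j : ℂ) - z)) = 0 ↔
          ∃ k, z = (μ k : ℂ))) := by
  set B : ℝ := 1 - ∑ i, b i with hB
  have hBpos : 0 < B := sub_pos.2 hbsum
  set c : Fin m → ℝ := fun j => σ j * b j / B with hc
  have hcpos (j : Fin m) : 0 < c j := div_pos (mul_pos (hσpos j) (hbpos j)) hBpos
  choose μ hσμ hμσ hμ using exists_secular_eq_zero hσmono hcpos
  have hμmono : StrictMono μ := fun i j hij => (hμσ i j hij).trans (hσμ j)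
  have hne (k j : Fin m) : μ k ≠ σ j := by
    rcases lt_or_ge k j with h | h
    · exact (hμσ k j h).ne
    · exact ((hσmono.monotone h).trans_lt (hσμ k)).ne'
  have heq (z : ℂ) : 1 + ∑ j, (σ j : ℂ) * (b j : ℂ) / ((1 - ∑ i, (b i : ℂ)) * ((σ j : ℂ) - z)) =
      1 + ∑ j, (c j : ℂ) / ((σ j : ℂ) - z) := by
    simp only [hc, hB, div_mul_eq_div_div]
    push_cast
    rfl
  have hμC (k : Fin m) : 1 + ∑ j, (c j : ℂ) / ((σ j : ℂ) - (μ k : ℂ)) = 0 := by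
    exact_mod_cast congrArg Complex.ofReal (hμ k)
  refine ⟨μ, hμmono, hσμ, fun j h => hμσ j _ (Fin.lt_def.2 (Nat.lt_succ_self _)), fun z hz => ?_⟩
  rw [heq]
  constructor
  · intro h0
    by_contra! hzμ
    have hinj : Function.Injective fun k => (μ k : ℂ) :=
      Complex.ofReal_injective.comp hμmono.injective
    have hcard := card_le_of_secular_eq_zero (fun j => (σ j : ℂ)) (fun j => (c j : ℂ))
      (insert z (Finset.univ.image fun k => (μ k : ℂ))) (by
        intro w hw
        rw [Finset.mem_insert, Finset.mem_image] at hw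
        rcases hw with rfl | ⟨k, -, rfl⟩
        · exact ⟨hz, h0⟩
        · exact ⟨fun j => Complex.ofReal_injective.ne (hne k j), hμC k⟩)
    rw [Finset.card_insert_of_notMem (by simpa using fun k => (hzμ k).symm),
      Finset.card_image_of_injective _ hinj, Finset.card_univ] at hcard
    omega
  · rintro ⟨k, rfl⟩
    exact hμC k
end

section
/- Fix m ≥ 1. Let D be the set of pairs (σ, b) ∈ ℝ^m × ℝ^m with 0 < σ_1 < σ_2 < … < σ_m, b_j > 0 for all j, and Σ_{j=1}^m b_j < 1. For (σ, b) ∈ D let μ(σ, b) = (μ_1, …, μ_m) be the increasing enumeration of the roots of equation (★). Then the map (σ, b) ↦ (σ, μ(σ, b)) is a bijection from D onto the set G = {(σ, μ) : 0 < σ_1 < … < σ_m, σ_j < μ_j < σ_{j+1} for j = 1, …, m−1, σ_m < μ_m}. -/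
open Finset

/-- `(σ, b)` belongs to the set `D`: `0 < σ 0 < … < σ (m-1)`, all `b j > 0`,
and `∑ j, b j < 1`. -/
def IsAdmissibleD (m : ℕ) (σ b : Fin m → ℝ) : Prop :=
  (∀ j, 0 < σ j) ∧ StrictMono σ ∧ (∀ j, 0 < b j) ∧ ∑ j, b j < 1

/-- `(σ, μ)` belongs to the set `G`: `0 < σ 0 < … < σ (m-1)`,
`σ j < μ j < σ (j+1)` for `j = 0, …, m-2`, and `σ (m-1) < μ (m-1)`. -/
def IsAdmissibleG (m : ℕ) (σ μ : Fin m → ℝ) : Prop :=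
  (∀ j, 0 < σ j) ∧ StrictMono σ ∧ (∀ j, σ j < μ j) ∧
    ∀ j : Fin m, ∀ h : (j : ℕ) + 1 < m, μ j < σ ⟨(j : ℕ) + 1, h⟩

/-- `μ` is the increasing enumeration of the roots of equation (★)
`1 + ∑ j, σ j * b j / ((1 - ∑ i, b i) * (σ j - λ)) = 0` (for `λ` avoiding the `σ j`). -/
def IsRootEnumeration (m : ℕ) (σ b μ : Fin m → ℝ) : Prop :=
  StrictMono μ ∧ ∀ z : ℝ, (∀ j, z ≠ σ j) →
    (1 + ∑ j, σ j * b j / ((1 - ∑ i, b i) * (σ j - z)) = 0 ↔ ∃ k, z = μ k)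

open Polynomial in
/-- The numerator of `1 + ∑ j, w j / (σ j - z)` over the common denominator `∏ j, (z - σ j)`. -/
noncomputable def secularPoly {m : ℕ} (σ w : Fin m → ℝ) : ℝ[X] :=
  Lagrange.nodal univ σ - ∑ j, C (w j) * Lagrange.nodal (univ.erase j) σ

lemma eval_secularPoly {m : ℕ} (σ w : Fin m → ℝ) (z : ℝ) :
    (secularPoly σ w).eval z =
      ∏ k, (z - σ k) - ∑ j, w j * ∏ k ∈ univ.erase j, (z - σ k) := by
  simp [secularPoly, Lagrange.eval_nodal, Polynomial.eval_finsetSum]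

lemma eval_secularPoly_node {m : ℕ} (σ w : Fin m → ℝ) (j : Fin m) :
    (secularPoly σ w).eval (σ j) = -(w j * ∏ k ∈ univ.erase j, (σ j - σ k)) := by
  rw [eval_secularPoly, prod_eq_zero (mem_univ j) (sub_self _), sum_eq_single j]
  · ring
  · intro i _ hij
    rw [prod_eq_zero (mem_erase.2 ⟨hij.symm, mem_univ j⟩) (sub_self _), mul_zero]
  · simp

lemma degree_sum_C_mul_nodal_erase_lt {m : ℕ} (σ w : Fin m → ℝ) :
    (∑ j, Polynomial.C (w j) * Lagrange.nodal (univ.erase j) σ).degree < (m : WithBot ℕ) := by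
  refine (Polynomial.degree_sum_le _ _).trans_lt ?_
  refine (Finset.sup_lt_iff (WithBot.bot_lt_coe m)).2 fun j _ => ?_
  rw [← Polynomial.smul_eq_C_mul]
  refine (Polynomial.degree_smul_le _ _).trans_lt ?_
  rw [Lagrange.degree_nodal, card_erase_of_mem (mem_univ j), card_univ, Fintype.card_fin]
  exact WithBot.coe_lt_coe.2 (Nat.sub_lt j.pos one_pos)

lemma degree_secularPoly {m : ℕ} (σ w : Fin m → ℝ) : (secularPoly σ w).degree = m := by
  have h : (Lagrange.nodal univ σ).degree = (m : WithBot ℕ) := by simp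
  rw [secularPoly, Polynomial.degree_sub_eq_left_of_degree_lt, h]
  rw [h]
  exact degree_sum_C_mul_nodal_erase_lt σ w

lemma monic_secularPoly {m : ℕ} (σ w : Fin m → ℝ) : (secularPoly σ w).Monic := by
  refine Lagrange.nodal_monic.sub_of_left ?_
  simpa using degree_sum_C_mul_nodal_erase_lt σ w

lemma secularPoly_eq_nodal_of_eval_eq {m : ℕ} {σ w μ v : Fin m → ℝ} (hv : Function.Injective v)
    (h : ∀ i, (secularPoly σ w).eval (v i) = (Lagrange.nodal univ μ).eval (v i)) :
    secularPoly σ w = Lagrange.nodal univ μ := by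
  refine Polynomial.eq_of_degree_sub_lt_of_eval_index_eq univ (v := v) hv.injOn ?_
    fun i _ => h i
  have hd : (secularPoly σ w).degree = (Lagrange.nodal univ μ).degree := by
    simp [degree_secularPoly]
  refine (Polynomial.degree_sub_lt_left hd (monic_secularPoly σ w).ne_zero ?_).trans_eq ?_
  · rw [monic_secularPoly σ w, Lagrange.nodal_monic (s := univ) (v := μ)]
  · simp [degree_secularPoly]

lemma secularPoly_eq_nodal_iff {m : ℕ} {σ w μ : Fin m → ℝ} (hσ : Function.Injective σ) :
    secularPoly σ w = Lagrange.nodal univ μ ↔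
      ∀ j, w j * ∏ k ∈ univ.erase j, (σ j - σ k) = -∏ k, (σ j - μ k) := by
  constructor
  · intro h j
    have := congrArg (Polynomial.eval (σ j)) h
    rw [eval_secularPoly_node, Lagrange.eval_nodal] at this
    linarith
  · intro h
    refine secularPoly_eq_nodal_of_eval_eq hσ fun j => ?_
    rw [eval_secularPoly_node, Lagrange.eval_nodal, h j, neg_neg]

lemma one_add_sum_div_eq_zero_iff {m : ℕ} (σ w : Fin m → ℝ) {z : ℝ} (hz : ∀ j, z ≠ σ j) :
    1 + ∑ j, w j / (σ j - z) = 0 ↔ (secularPoly σ w).eval z = 0 := by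
  have hne : ∏ k, (z - σ k) ≠ 0 := prod_ne_zero_iff.2 fun k _ => sub_ne_zero.2 (hz k)
  have key : (secularPoly σ w).eval z = (∏ k, (z - σ k)) * (1 + ∑ j, w j / (σ j - z)) := by
    rw [eval_secularPoly, mul_add, mul_one, mul_sum, sub_eq_add_neg, ← sum_neg_distrib]
    congr 1
    refine sum_congr rfl fun j _ => ?_
    rw [← mul_prod_erase univ (fun k => z - σ k) (mem_univ j)]
    have h1 : σ j - z ≠ 0 := sub_ne_zero.2 (hz j).symm
    field_simp
    ring
  rw [key, mul_eq_zero, or_iff_right hne]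

lemma isRootEnumeration_iff {m : ℕ} {σ b w μ : Fin m → ℝ}
    (hw : ∀ j, w j = σ j * b j / (1 - ∑ i, b i)) (hμ : StrictMono μ)
    (hμσ : ∀ k j, μ k ≠ σ j) :
    IsRootEnumeration m σ b μ ↔ secularPoly σ w = Lagrange.nodal univ μ := by
  have hsum : ∀ z, ∑ j, σ j * b j / ((1 - ∑ i, b i) * (σ j - z)) = ∑ j, w j / (σ j - z) := by
    intro z
    refine sum_congr rfl fun j _ => ?_
    rw [hw, div_div]
  constructor
  · rintro ⟨-, h⟩
    refine secularPoly_eq_nodal_of_eval_eq hμ.injective fun k => ?_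
    have h0 := (h (μ k) (hμσ k)).2 ⟨k, rfl⟩
    rw [hsum, one_add_sum_div_eq_zero_iff σ w (hμσ k)] at h0
    rw [h0, Lagrange.eval_nodal_at_node (mem_univ k)]
  · intro h
    refine ⟨hμ, fun z hz => ?_⟩
    rw [hsum, one_add_sum_div_eq_zero_iff σ w hz, h, Lagrange.eval_nodal, prod_eq_zero_iff]
    simp [sub_eq_zero]

lemma IsAdmissibleG.lt_of_lt {m : ℕ} {σ μ : Fin m → ℝ} (h : IsAdmissibleG m σ μ) {i j : Fin m}
    (hij : i < j) : μ i < σ j := by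
  obtain ⟨-, hσ, -, h4⟩ := h
  have hi : (i : ℕ) + 1 < m := lt_of_le_of_lt (Nat.succ_le_of_lt hij) j.2
  exact (h4 i hi).trans_le (hσ.monotone (Nat.succ_le_of_lt hij))

lemma IsAdmissibleG.lt_of_le {m : ℕ} {σ μ : Fin m → ℝ} (h : IsAdmissibleG m σ μ) {i j : Fin m}
    (hij : i ≤ j) : σ i < μ j :=
  (h.2.1.monotone hij).trans_lt (h.2.2.1 j)

lemma IsAdmissibleG.strictMono {m : ℕ} {σ μ : Fin m → ℝ} (h : IsAdmissibleG m σ μ) :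
    StrictMono μ := fun _ j hij => (h.lt_of_lt hij).trans (h.2.2.1 j)

lemma IsAdmissibleG.ne {m : ℕ} {σ μ : Fin m → ℝ} (h : IsAdmissibleG m σ μ) (k j : Fin m) :
    μ k ≠ σ j := by
  rcases lt_or_ge k j with hkj | hkj
  · exact (h.lt_of_lt hkj).ne
  · exact (h.lt_of_le hkj).ne'

lemma prod_erase_sub_ne_zero {m : ℕ} {σ : Fin m → ℝ} (hσ : Function.Injective σ) (j : Fin m) :
    ∏ k ∈ univ.erase j, (σ j - σ k) ≠ 0 :=
  prod_ne_zero_iff.2 fun _ hk => sub_ne_zero.2 (hσ.ne (ne_of_mem_erase hk).symm)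

/-- The residues attached to interlacing data are positive. -/
lemma IsAdmissibleG.neg_prod_div_prod_pos {m : ℕ} {σ μ : Fin m → ℝ} (h : IsAdmissibleG m σ μ)
    (j : Fin m) : 0 < -(∏ k, (σ j - μ k)) / ∏ k ∈ univ.erase j, (σ j - σ k) := by
  rw [← mul_prod_erase univ (fun k => σ j - μ k) (mem_univ j), ← neg_mul, mul_div_assoc,
    ← prod_div_distrib]
  refine mul_pos (by linarith [h.2.2.1 j]) (prod_pos fun k hk => ?_)
  rcases lt_or_gt_of_ne (ne_of_mem_erase hk) with hkj | hkj
  · exact div_pos (sub_pos.2 (h.lt_of_lt hkj)) (sub_pos.2 (h.2.1 hkj))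
  · exact div_pos_of_neg_of_neg (sub_neg.2 (h.lt_of_le hkj.le)) (sub_neg.2 (h.2.1 hkj))

/-- The secular polynomial changes sign between consecutive nodes. -/
lemma eval_secularPoly_mul_eval_neg {m : ℕ} {σ w : Fin m → ℝ} (hσ : StrictMono σ)
    (hw : ∀ j, 0 < w j) {i j : Fin m} (hij : (j : ℕ) = i + 1) :
    (secularPoly σ w).eval (σ i) * (secularPoly σ w).eval (σ j) < 0 := by
  have hlt : i < j := Fin.lt_def.2 (by omega)
  rw [eval_secularPoly_node, eval_secularPoly_node,
    ← mul_prod_erase (univ.erase i) (fun k => σ i - σ k) (mem_erase.2 ⟨hlt.ne', mem_univ j⟩),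
    ← mul_prod_erase (univ.erase j) (fun k => σ j - σ k) (mem_erase.2 ⟨hlt.ne, mem_univ i⟩),
    erase_right_comm (a := j) (b := i)]
  have hpos : 0 < (∏ k ∈ (univ.erase i).erase j, (σ i - σ k)) *
      ∏ k ∈ (univ.erase i).erase j, (σ j - σ k) := by
    rw [← prod_mul_distrib]
    refine prod_pos fun k hk => ?_
    have hkj : k ≠ j := ne_of_mem_erase hk
    have hki : k ≠ i := ne_of_mem_erase (mem_of_mem_erase hk)
    rcases lt_or_gt_of_ne hki with hk' | hk'
    · exact mul_pos (sub_pos.2 (hσ hk')) (sub_pos.2 (hσ (hk'.trans hlt)))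
    · have hjk : j < k := by
        rw [Fin.lt_def] at *
        have := Fin.val_ne_of_ne hkj
        omega
      exact mul_pos_of_neg_of_neg (sub_neg.2 (hσ hk')) (sub_neg.2 (hσ hjk))
  have h1 : 0 < w i * w j * (σ j - σ i) ^ 2 :=
    mul_pos (mul_pos (hw i) (hw j)) (pow_pos (sub_pos.2 (hσ hlt)) 2)
  linarith [mul_pos h1 hpos]

lemma exists_root_of_mul_neg (p : Polynomial ℝ) {x y : ℝ} (hxy : x < y)
    (h : p.eval x * p.eval y < 0) : ∃ z, x < z ∧ z < y ∧ p.eval z = 0 := by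
  have hc : ContinuousOn (fun t => p.eval t) (Set.Icc x y) := p.continuous.continuousOn
  rcases mul_neg_iff.1 h with ⟨hx, hy⟩ | ⟨hx, hy⟩
  · obtain ⟨z, hz, hz0⟩ := intermediate_value_Ioo' hxy.le hc ⟨hy, hx⟩
    exact ⟨z, hz.1, hz.2, hz0⟩
  · obtain ⟨z, hz, hz0⟩ := intermediate_value_Ioo hxy.le hc ⟨hx, hy⟩
    exact ⟨z, hz.1, hz.2, hz0⟩

/-- The secular polynomial has a root to the right of its last node. -/
lemma exists_root_secularPoly_gt {m : ℕ} {σ w : Fin m → ℝ} (hσ : StrictMono σ)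
    (hw : ∀ j, 0 < w j) {j : Fin m} (hj : ∀ k, k ≤ j) :
    ∃ z, σ j < z ∧ (secularPoly σ w).eval z = 0 := by
  have hneg : (secularPoly σ w).eval (σ j) < 0 := by
    rw [eval_secularPoly_node, neg_lt_zero]
    exact mul_pos (hw j) (prod_pos fun k hk =>
      sub_pos.2 (hσ (lt_of_le_of_ne (hj k) (ne_of_mem_erase hk))))
  have htop : Filter.Tendsto (fun x => (secularPoly σ w).eval x) Filter.atTop Filter.atTop := by
    refine Polynomial.tendsto_atTop_of_leadingCoeff_nonneg _ ?_ ?_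
    · rw [degree_secularPoly]
      exact_mod_cast j.pos
    · rw [(monic_secularPoly σ w).leadingCoeff]
      exact zero_le_one
  obtain ⟨y, hy, hjy⟩ :=
    ((htop.eventually_gt_atTop 0).and (Filter.eventually_gt_atTop (σ j))).exists
  obtain ⟨z, hz, -, hz0⟩ := exists_root_of_mul_neg _ hjy (mul_neg_of_neg_of_pos hneg hy)
  exact ⟨z, hz, hz0⟩

lemma exists_interlacing_roots {m : ℕ} {σ w : Fin m → ℝ} (hpos : ∀ j, 0 < σ j)
    (hσ : StrictMono σ) (hw : ∀ j, 0 < w j) :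
    ∃ μ, IsAdmissibleG m σ μ ∧ secularPoly σ w = Lagrange.nodal univ μ := by
  have hex : ∀ j : Fin m, ∃ z, σ j < z ∧ (∀ h : (j : ℕ) + 1 < m, z < σ ⟨(j : ℕ) + 1, h⟩) ∧
      (secularPoly σ w).eval z = 0 := by
    intro j
    by_cases h : (j : ℕ) + 1 < m
    · obtain ⟨z, h1, h2, h3⟩ := exists_root_of_mul_neg (secularPoly σ w)
        (hσ (Fin.lt_def.2 (Nat.lt_succ_self j) : j < ⟨(j : ℕ) + 1, h⟩))
        (eval_secularPoly_mul_eval_neg hσ hw rfl)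
      exact ⟨z, h1, fun _ => h2, h3⟩
    · obtain ⟨z, h1, h2⟩ := exists_root_secularPoly_gt hσ hw (j := j)
        fun k => Fin.le_def.2 (by omega)
      exact ⟨z, h1, fun h' => absurd h' h, h2⟩
  choose μ h1 h2 h3 using hex
  have hG : IsAdmissibleG m σ μ := ⟨hpos, hσ, h1, h2⟩
  refine ⟨μ, hG, secularPoly_eq_nodal_of_eval_eq hG.strictMono.injective fun k => ?_⟩
  rw [h3, Lagrange.eval_nodal_at_node (mem_univ k)]

lemma strictMono_eq_of_nodal_eq {m : ℕ} {μ ν : Fin m → ℝ} (hμ : StrictMono μ) (hν : StrictMono ν)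
    (h : Lagrange.nodal univ μ = Lagrange.nodal univ ν) : μ = ν := by
  have hr : ∀ (ρ : Fin m → ℝ) (z : ℝ),
      (Lagrange.nodal univ ρ).eval z = 0 ↔ z ∈ Set.range ρ := by
    intro ρ z
    rw [Lagrange.eval_nodal, prod_eq_zero_iff]
    simp [sub_eq_zero, eq_comm]
  refine (hμ.range_inj hν).1 (Set.ext fun z => ?_)
  rw [← hr, ← hr, h]

/-- The weights `b` can be recovered from the residues `σ j * b j / (1 - ∑ i, b i)`. -/
lemma eq_of_residue_eq {m : ℕ} {σ b b' : Fin m → ℝ} (hσ : ∀ j, 0 < σ j) (hb : ∑ j, b j < 1)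
    (hb' : ∑ j, b' j < 1)
    (h : ∀ j, σ j * b j / (1 - ∑ i, b i) = σ j * b' j / (1 - ∑ i, b' i)) : b = b' := by
  have hc : 0 < 1 - ∑ i, b i := sub_pos.2 hb
  have hc' : 0 < 1 - ∑ i, b' i := sub_pos.2 hb'
  have h1 : ∀ j, b j * (1 - ∑ i, b' i) = b' j * (1 - ∑ i, b i) := by
    intro j
    have := h j
    rw [div_eq_div_iff hc.ne' hc'.ne'] at this
    exact mul_left_cancel₀ (hσ j).ne' (by linarith)
  have h2 : (∑ j, b j) * (1 - ∑ i, b' i) = (∑ j, b' j) * (1 - ∑ i, b i) := by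
    rw [sum_mul, sum_mul]
    exact sum_congr rfl fun j _ => h1 j
  have h3 : ∑ j, b j = ∑ j, b' j := by linarith
  funext j
  have := h1 j
  rw [h3] at this
  exact mul_right_cancel₀ hc'.ne' this

/-- Every positive vector arises as the residues of admissible data. -/
lemma exists_weights_of_residues {m : ℕ} {σ w : Fin m → ℝ} (hpos : ∀ j, 0 < σ j)
    (hw : ∀ j, 0 < w j) :
    ∃ b : Fin m → ℝ, (∀ j, 0 < b j) ∧ ∑ j, b j < 1 ∧
      ∀ j, w j = σ j * b j / (1 - ∑ i, b i) := by
  have hT : 0 ≤ ∑ i, w i / σ i := sum_nonneg fun i _ => (div_pos (hw i) (hpos i)).le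
  set T := ∑ i, w i / σ i
  have hT1 : 0 < 1 + T := by linarith
  have hsum : ∑ j, w j / σ j / (1 + T) = T / (1 + T) := by rw [← sum_div]
  refine ⟨fun j => w j / σ j / (1 + T),
    fun j => div_pos (div_pos (hw j) (hpos j)) hT1, ?_, fun j => ?_⟩
  · rw [hsum, div_lt_one hT1]
    linarith
  · have hc : 1 - T / (1 + T) = 1 / (1 + T) := by
      field_simp
      ring
    have := (hpos j).ne'
    rw [hsum, hc]
    field_simp

/-- The map `(σ, b) ↦ (σ, μ(σ, b))`, sending admissible data to the
increasing enumeration of the roots of equation (★), is a bijection from `D` onto `G`: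
every `(σ, b) ∈ D` yields a unique root enumeration `μ` with `(σ, μ) ∈ G`, and for every
`(σ, μ) ∈ G` there is a unique `b` with `(σ, b) ∈ D` whose root enumeration is `μ`. -/
theorem roots_map_bijective (m : ℕ) (hm : 1 ≤ m) :
    (∀ σ b : Fin m → ℝ, IsAdmissibleD m σ b →
      ∃! μ : Fin m → ℝ, IsRootEnumeration m σ b μ ∧ IsAdmissibleG m σ μ) ∧
    (∀ σ μ : Fin m → ℝ, IsAdmissibleG m σ μ →
      ∃! b : Fin m → ℝ, IsAdmissibleD m σ b ∧ IsRootEnumeration m σ b μ) := by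
  constructor
  · rintro σ b ⟨hpos, hσ, hb, hb1⟩
    have hw : ∀ j, 0 < σ j * b j / (1 - ∑ i, b i) := fun j =>
      div_pos (mul_pos (hpos j) (hb j)) (sub_pos.2 hb1)
    obtain ⟨μ, hG, hμ⟩ := exists_interlacing_roots hpos hσ hw
    refine ⟨μ, ⟨(isRootEnumeration_iff (fun _ => rfl) hG.strictMono hG.ne).2 hμ, hG⟩, ?_⟩
    rintro ν ⟨hν, hG'⟩
    have hν' := (isRootEnumeration_iff (fun _ => rfl) hG'.strictMono hG'.ne).1 hν
    exact strictMono_eq_of_nodal_eq hG'.strictMono hG.strictMono (hν'.symm.trans hμ)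
  · intro σ μ hG
    have hσ := hG.2.1
    obtain ⟨b, hb, hb1, hbw⟩ := exists_weights_of_residues hG.1 hG.neg_prod_div_prod_pos
    refine ⟨b, ⟨⟨hG.1, hσ, hb, hb1⟩, (isRootEnumeration_iff hbw hG.strictMono hG.ne).2 <|
      (secularPoly_eq_nodal_iff hσ.injective).2 fun j =>
        div_mul_cancel₀ _ (prod_erase_sub_ne_zero hσ.injective j)⟩, ?_⟩
    rintro b' ⟨⟨-, -, -, hb1'⟩, hr⟩
    have h' := (secularPoly_eq_nodal_iff hσ.injective).1
      ((isRootEnumeration_iff (fun _ => rfl) hG.strictMono hG.ne).1 hr)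
    refine eq_of_residue_eq hG.1 hb1' hb1 fun j => ?_
    rw [← hbw j]
    exact eq_div_of_mul_eq (prod_erase_sub_ne_zero hσ.injective j) (h' j)
end

section
/- Let 0 < σ_1 < σ_2 < … < σ_m, let b_1, …, b_m > 0 with Σ_{j=1}^m b_j < 1, and let M be the associated m × m symmetric matrix. If λ ∈ ℝ \ ({0} ∪ {σ_1, …, σ_m}) satisfies equation (★), i.e. 1 + Σ_{j=1}^m σ_j b_j / ((1 − Σ_{i=1}^m b_i)(σ_j − λ)) = 0, then det(M − λ^{−1} I) = 0, where I is the m × m identity matrix; equivalently, λ^{−1} is an eigenvalue of M. -/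
open Finset

/-- The secular equation for a rank-one perturbation of a diagonal matrix: if `μ` differs from
every `d i` and `∑ i, u i ^ 2 / (d i - μ) = 1`, then `u i / (d i - μ)` is an eigenvector of
`diagonal d - vecMulVec u u` with eigenvalue `μ`. -/
theorem Matrix.diagonal_sub_vecMulVec_mulVec_of_secular {n K : Type*} [Fintype n] [DecidableEq n]
    [Field K] {d u : n → K} {μ : K} (hd : ∀ i, d i ≠ μ) (h : ∑ i, u i ^ 2 / (d i - μ) = 1) :
    (Matrix.diagonal d - Matrix.vecMulVec u u).mulVec (fun i => u i / (d i - μ)) =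
      μ • fun i => u i / (d i - μ) := by
  have hdot : dotProduct u (fun i => u i / (d i - μ)) = 1 := by
    rw [← h]
    exact Finset.sum_congr rfl fun i _ => by ring
  ext i
  have hi : d i - μ ≠ 0 := sub_ne_zero.2 (hd i)
  simp only [Matrix.sub_mulVec, Matrix.vecMulVec_mulVec, hdot, Pi.sub_apply,
    Matrix.mulVec_diagonal, Pi.smul_apply, smul_eq_mul, MulOpposite.op_one, one_smul]
  field_simp
  ring

/-- Let `0 < σ 0 < … < σ (m-1)`, `b i > 0` with `∑ i, b i < 1`, and
let `M` be the associated symmetric matrix. If a real `z ∉ {0, σ 0, …, σ (m-1)}`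
satisfies equation (★), then `det (M - z⁻¹ • I) = 0`; equivalently, `z⁻¹` is an
eigenvalue of `M`. -/
theorem star_root_gives_eigenvalue
    (m : ℕ) (hm : 1 ≤ m) (σ b : Fin m → ℝ)
    (hσpos : ∀ i, 0 < σ i) (hσmono : StrictMono σ)
    (hb : ∀ i, 0 < b i) (hbsum : ∑ i, b i < 1)
    (M : Matrix (Fin m) (Fin m) ℝ)
    (hM : ∀ i j, M i j = if i = j then (1 - b i) / σ i
        else -Real.sqrt (b i * b j / (σ i * σ j)))
    (z : ℝ) (hz0 : z ≠ 0) (hzσ : ∀ j, z ≠ σ j)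
    (heq : 1 + ∑ j, σ j * b j / ((1 - ∑ i, b i) * (σ j - z)) = 0) :
    (M - z⁻¹ • (1 : Matrix (Fin m) (Fin m) ℝ)).det = 0 ∧
    Module.End.HasEigenvalue (Matrix.toLin' M) z⁻¹ := by
  have hsum : 1 - ∑ i, b i ≠ 0 := by linarith
  set u : Fin m → ℝ := fun i => Real.sqrt (b i / σ i) with hu
  have hu_sq (i : Fin m) : u i ^ 2 = b i / σ i :=
    Real.sq_sqrt (div_pos (hb i) (hσpos i)).le
  have hM_eq : M = Matrix.diagonal (fun i => (σ i)⁻¹) - Matrix.vecMulVec u u := by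
    ext i j
    rw [hM, Matrix.sub_apply, Matrix.vecMulVec_apply]
    split_ifs with hij
    · subst hij
      rw [Matrix.diagonal_apply_eq, ← sq, hu_sq]
      ring
    · rw [Matrix.diagonal_apply_ne _ hij, zero_sub, hu,
        ← Real.sqrt_mul (div_pos (hb i) (hσpos i)).le, div_mul_div_comm]
  have hd (i : Fin m) : (σ i)⁻¹ ≠ z⁻¹ := fun h => hzσ i (inv_injective h).symm
  have hsecular : ∑ i, u i ^ 2 / ((σ i)⁻¹ - z⁻¹) = 1 := by
    have hterm (i : Fin m) : u i ^ 2 / ((σ i)⁻¹ - z⁻¹) =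
        b i - (1 - ∑ i, b i) * (σ i * b i / ((1 - ∑ i, b i) * (σ i - z))) := by
      have hσ := (hσpos i).ne'
      have h₁ : σ i - z ≠ 0 := sub_ne_zero.2 (hzσ i).symm
      have h₂ : z - σ i ≠ 0 := sub_ne_zero.2 (hzσ i)
      rw [hu_sq, inv_sub_inv hσ hz0]
      field_simp
      ring
    rw [Finset.sum_congr rfl fun i _ => hterm i, Finset.sum_sub_distrib, ← Finset.mul_sum]
    linear_combination -(1 - ∑ i, b i) * heq
  have hv := Matrix.diagonal_sub_vecMulVec_mulVec_of_secular hd hsecular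
  rw [← hM_eq] at hv
  set v : Fin m → ℝ := fun i => u i / ((σ i)⁻¹ - z⁻¹) with hv_def
  have hv_ne : v ≠ 0 := fun h =>
    div_ne_zero (Real.sqrt_pos.2 (div_pos (hb ⟨0, hm⟩) (hσpos ⟨0, hm⟩))).ne'
      (sub_ne_zero.2 (hd ⟨0, hm⟩)) (congrFun h ⟨0, hm⟩)
  refine ⟨Matrix.exists_mulVec_eq_zero_iff.1 ⟨v, hv_ne, ?_⟩,
    Module.End.hasEigenvalue_of_hasEigenvector
      (x := v) ⟨Module.End.mem_eigenspace_iff.2 ?_, hv_ne⟩⟩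
  · rw [Matrix.sub_mulVec, Matrix.smul_mulVec, Matrix.one_mulVec, hv, sub_self]
  · rw [Matrix.toLin'_apply, hv]
end

section
/- Let 0 < σ_1 < σ_2 < … < σ_m, let b_1, …, b_m > 0 with Σ_{j=1}^m b_j < 1, let μ_1 < μ_2 < … < μ_m be the roots of equation (★), and let M be the associated m × m symmetric matrix. Then the set of eigenvalues of M is exactly {μ_1^{−1}, μ_2^{−1}, …, μ_m^{−1}}; in particular M has m pairwise distinct positive eigenvalues, each of which is simple. -/
open Finset

/-- Entrywise form of the eigenvector equation of `diagonal (σ⁻¹) - v vᵀ`. -/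
theorem eigenvector_eq_of_rank_one_update {ι : Type*} [Fintype ι] [DecidableEq ι]
    {d v x : ι → ℝ} {z : ℝ}
    (h : (Matrix.diagonal d - Matrix.vecMulVec v v).mulVec x = z • x) (i : ι) :
    (d i - z) * x i = v i * ∑ j, v j * x j := by
  have hi := congrFun h i
  rw [Matrix.sub_mulVec, Pi.sub_apply, Matrix.mulVec_diagonal] at hi
  have hv : (Matrix.vecMulVec v v).mulVec x i = v i * ∑ j, v j * x j := by
    simp [Matrix.mulVec, Matrix.vecMulVec, dotProduct, Finset.mul_sum, mul_assoc]
  rw [hv, Pi.smul_apply, smul_eq_mul] at hi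
  linarith

/-- An eigenvector of `diagonal d - v vᵀ` is not orthogonal to `v`, when `d` is injective and
`v` has no zero entry. -/
theorem sum_mul_eigenvector_ne_zero {ι : Type*} [Fintype ι] {d v x : ι → ℝ} {z : ℝ}
    (hd : Function.Injective d) (hv : ∀ i, v i ≠ 0)
    (h : ∀ i, (d i - z) * x i = v i * ∑ j, v j * x j) (hx : x ≠ 0) :
    ∑ j, v j * x j ≠ 0 := by
  intro hs
  obtain ⟨i, hi⟩ := Function.ne_iff.mp hx
  have key : ∀ j, x j ≠ 0 → d j = z := fun j hj => by
    have := h j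
    rw [hs, mul_zero] at this
    exact sub_eq_zero.mp ((mul_eq_zero.mp this).resolve_right hj)
  have hz : ∀ j, j ≠ i → x j = 0 := fun j hji => by
    by_contra hj
    exact hji (hd ((key j hj).trans (key i hi).symm))
  rw [Finset.sum_eq_single i (fun j _ hj => by rw [hz j hj, mul_zero])
    (fun h => absurd (Finset.mem_univ i) h)] at hs
  exact mul_ne_zero (hv i) hi hs

/-- The secular equation of `diagonal d - v vᵀ`. -/
theorem secular_equation {ι : Type*} [Fintype ι] {d v x : ι → ℝ} {z : ℝ}
    (hd : Function.Injective d) (hv : ∀ i, v i ≠ 0)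
    (h : ∀ i, (d i - z) * x i = v i * ∑ j, v j * x j) (hx : x ≠ 0) :
    (∀ i, d i - z ≠ 0) ∧ ∑ i, v i ^ 2 / (d i - z) = 1 := by
  have hs := sum_mul_eigenvector_ne_zero hd hv h hx
  have hne : ∀ i, d i - z ≠ 0 := fun i hi => by
    have := h i
    rw [hi, zero_mul] at this
    exact mul_ne_zero (hv i) hs this.symm
  refine ⟨hne, mul_right_cancel₀ hs ?_⟩
  rw [one_mul, Finset.sum_mul]
  refine Finset.sum_congr rfl fun i _ => ?_
  rw [div_mul_eq_mul_div, div_eq_iff (hne i)]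
  linear_combination -(v i) * h i

/-- Two eigenvectors of `diagonal d - v vᵀ` for the same eigenvalue are proportional. -/
theorem eigenvector_proportional {ι : Type*} [Fintype ι] {d v x y : ι → ℝ} {z : ℝ}
    (hd : Function.Injective d) (hv : ∀ i, v i ≠ 0)
    (h : ∀ i, (d i - z) * x i = v i * ∑ j, v j * x j) (hx : x ≠ 0)
    (h' : ∀ i, (d i - z) * y i = v i * ∑ j, v j * y j) :
    ∃ c : ℝ, c • x = y := by
  have hs := sum_mul_eigenvector_ne_zero hd hv h hx
  have hne := (secular_equation hd hv h hx).1
  refine ⟨(∑ j, v j * y j) / ∑ j, v j * x j, funext fun i => ?_⟩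
  rw [Pi.smul_apply, smul_eq_mul, div_mul_eq_mul_div, div_eq_iff hs]
  apply mul_left_cancel₀ (hne i)
  linear_combination (∑ j, v j * y j) * h i - (∑ j, v j * x j) * h' i

/-- If `∑ b < 1`, a solution `z` of `∑ b / (1 - z σ) = 1` is positive, and its inverse solves
equation (★). -/
theorem pos_and_inv_root_of_secular_equation {ι : Type*} [Fintype ι] {σ b : ι → ℝ} {z : ℝ}
    (hσ : ∀ i, 0 < σ i) (hb : ∀ i, 0 < b i) (hbsum : ∑ i, b i < 1)
    (hne : ∀ i, 1 - z * σ i ≠ 0) (h : ∑ i, b i / (1 - z * σ i) = 1) :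
    0 < z ∧ (∀ j, z⁻¹ ≠ σ j) ∧
      1 + ∑ j, σ j * b j / ((1 - ∑ i, b i) * (σ j - z⁻¹)) = 0 := by
  have hz : 0 < z := by
    by_contra! hz
    have : ∑ i, b i / (1 - z * σ i) ≤ ∑ i, b i := Finset.sum_le_sum fun i _ =>
      div_le_self (hb i).le (by nlinarith [hσ i])
    linarith
  have hB : 1 - ∑ i, b i ≠ 0 := by linarith
  have hσz : ∀ j, z⁻¹ ≠ σ j := fun j hj => hne j (by
    rw [← hj, mul_inv_cancel₀ hz.ne', sub_self])
  refine ⟨hz, hσz, ?_⟩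
  have hterm : ∀ j, σ j * b j / ((1 - ∑ i, b i) * (σ j - z⁻¹)) =
      (b j - b j / (1 - z * σ j)) / (1 - ∑ i, b i) := fun j => by
    have h1 := hne j
    have h2 : σ j - z⁻¹ = -(1 - z * σ j) / z := by
      field_simp
      ring
    have h3 : b j - b j / (1 - z * σ j) = -(z * σ j * b j) / (1 - z * σ j) := by
      rw [eq_div_iff h1, sub_mul, div_mul_cancel₀ _ h1]
      ring
    rw [h2, h3]
    generalize 1 - ∑ i, b i = B at hB
    generalize 1 - z * σ j = w at h1
    field_simp
  rw [Finset.sum_congr rfl fun j _ => hterm j, ← Finset.sum_div, Finset.sum_sub_distrib, h]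
  field_simp
  ring

/-- Let `0 < σ 0 < … < σ (m-1)`, `b i > 0` with `∑ i, b i < 1`, let
`μ 0 < … < μ (m-1)` be the roots of equation (★), and let `M` be the associated
symmetric matrix. Then the eigenvalues of `M` are exactly `(μ k)⁻¹`; in particular `M`
has `m` pairwise distinct positive eigenvalues, each of which is simple. -/
theorem eigenvalues_of_M_are_inverse_roots
    (m : ℕ) (hm : 1 ≤ m) (σ b μ : Fin m → ℝ)
    (hσpos : ∀ i, 0 < σ i) (hσmono : StrictMono σ)
    (hb : ∀ i, 0 < b i) (hbsum : ∑ i, b i < 1)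
    (hμmono : StrictMono μ)
    (hroots : ∀ z : ℝ, (∀ j, z ≠ σ j) →
      (1 + ∑ j, σ j * b j / ((1 - ∑ i, b i) * (σ j - z)) = 0 ↔ ∃ k, z = μ k))
    (M : Matrix (Fin m) (Fin m) ℝ)
    (hM : ∀ i j, M i j = if i = j then (1 - b i) / σ i
        else -Real.sqrt (b i * b j / (σ i * σ j))) :
    (∀ k, 0 < μ k) ∧
    Function.Injective (fun k : Fin m => (μ k)⁻¹) ∧
    (∀ z : ℝ, Module.End.HasEigenvalue (Matrix.toLin' M) z ↔ ∃ k, z = (μ k)⁻¹) ∧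
    (∀ k, Module.finrank ℝ
        (Module.End.eigenspace (Matrix.toLin' M) ((μ k)⁻¹)) = 1) := by
  set d : Fin m → ℝ := fun i => (σ i)⁻¹
  set v : Fin m → ℝ := fun i => Real.sqrt (b i / σ i)
  have hd : Function.Injective d := fun i j hij => hσmono.injective (inv_injective hij)
  have hq : ∀ i, 0 < b i / σ i := fun i => div_pos (hb i) (hσpos i)
  have hv : ∀ i, v i ≠ 0 := fun i => (Real.sqrt_pos.mpr (hq i)).ne'
  have hvsq : ∀ i, v i ^ 2 = b i / σ i := fun i => Real.sq_sqrt (hq i).le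
  have hMdv : M = Matrix.diagonal d - Matrix.vecMulVec v v := by
    ext i j
    rw [hM, Matrix.sub_apply, Matrix.vecMulVec_apply]
    split_ifs with hij
    · subst hij
      rw [Matrix.diagonal_apply_eq, ← sq, hvsq, sub_div, one_div]
    · rw [Matrix.diagonal_apply_ne _ hij, zero_sub, ← Real.sqrt_mul (hq i).le,
        div_mul_div_comm]
  have hMherm : M.IsHermitian := by
    rw [hMdv]
    refine Matrix.IsHermitian.ext fun i j => ?_
    simp only [Matrix.sub_apply, Matrix.vecMulVec_apply, star_trivial, mul_comm (v j)]
    rw [← Matrix.transpose_apply (Matrix.diagonal d), Matrix.diagonal_transpose]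
  have hvec : ∀ {x : Fin m → ℝ} {z : ℝ}, M.mulVec x = z • x →
      ∀ i, (d i - z) * x i = v i * ∑ j, v j * x j := fun h =>
    eigenvector_eq_of_rank_one_update (hMdv ▸ h)
  have hroot : ∀ {x : Fin m → ℝ} {z : ℝ}, M.mulVec x = z • x → x ≠ 0 →
      0 < z ∧ ∃ k, z = (μ k)⁻¹ := fun {x z} h hx => by
    obtain ⟨hne, hsec⟩ := secular_equation hd hv (hvec h) hx
    have hfac : ∀ i, d i - z = (1 - z * σ i) / σ i := fun i => by
      rw [sub_div, one_div, mul_div_cancel_right₀ _ (hσpos i).ne']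
    have hne' : ∀ i, 1 - z * σ i ≠ 0 := fun i hi => hne i (by rw [hfac, hi, zero_div])
    have hsec' : ∑ i, b i / (1 - z * σ i) = 1 := by
      refine (Finset.sum_congr rfl fun i _ => ?_).trans hsec
      rw [hvsq, hfac, div_div_div_cancel_right₀ (hσpos i).ne']
    obtain ⟨hz, hzσ, hstar⟩ :=
      pos_and_inv_root_of_secular_equation hσpos hb hbsum hne' hsec'
    obtain ⟨k, hk⟩ := (hroots z⁻¹ hzσ).mp hstar
    exact ⟨hz, k, by rw [← hk, inv_inv]⟩
  have hbasis_eq : ∀ i, M.mulVec (hMherm.eigenvectorBasis i).ofLp =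
      hMherm.eigenvalues i • (hMherm.eigenvectorBasis i).ofLp := hMherm.mulVec_eigenvectorBasis
  have hbasis_ne : ∀ i, (hMherm.eigenvectorBasis i).ofLp ≠ 0 := fun i h =>
    hMherm.eigenvectorBasis.orthonormal.ne_zero i ((WithLp.ofLp_eq_zero 2).mp h)
  choose f hf using fun i => (hroot (hbasis_eq i) (hbasis_ne i)).2
  have hf_inj : Function.Injective f := fun i j hij => by
    by_contra hne
    have hval : hMherm.eigenvalues j = hMherm.eigenvalues i := by rw [hf i, hf j, hij]
    obtain ⟨c, hc⟩ := eigenvector_proportional hd hv (hvec (hbasis_eq i)) (hbasis_ne i)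
      (hvec (hval ▸ hbasis_eq j))
    have hc' : c • hMherm.eigenvectorBasis i = hMherm.eigenvectorBasis j :=
      WithLp.ofLp_injective 2 hc
    have hzero : inner ℝ (hMherm.eigenvectorBasis j) (hMherm.eigenvectorBasis j) = (0 : ℝ) := by
      nth_rewrite 1 [← hc']
      rw [inner_smul_left, hMherm.eigenvectorBasis.orthonormal.2 hne, mul_zero]
    exact hMherm.eigenvectorBasis.orthonormal.ne_zero j (inner_self_eq_zero.mp hzero)
  have hex : ∀ k, ∃ x : Fin m → ℝ, x ≠ 0 ∧ M.mulVec x = (μ k)⁻¹ • x := fun k => by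
    obtain ⟨i, rfl⟩ := Finite.surjective_of_injective hf_inj k
    exact ⟨_, hbasis_ne i, hf i ▸ hbasis_eq i⟩
  refine ⟨fun k => ?_, inv_injective.comp hμmono.injective, fun z => ⟨fun hz => ?_, ?_⟩,
    fun k => ?_⟩
  · obtain ⟨x, hx, h⟩ := hex k
    exact inv_pos.mp (hroot h hx).1
  · obtain ⟨x, hx⟩ := hz.exists_hasEigenvector
    exact (hroot (by simpa using hx.apply_eq_smul) hx.2).2
  · rintro ⟨k, rfl⟩
    obtain ⟨x, hx, h⟩ := hex k
    exact Module.End.hasEigenvalue_of_hasEigenvector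
      (Module.End.hasEigenvector_iff.mpr ⟨Module.End.mem_eigenspace_iff.mpr (by simpa using h), hx⟩)
  · obtain ⟨x, hx, h⟩ := hex k
    refine finrank_eq_one_iff'.mpr
      ⟨⟨x, Module.End.mem_eigenspace_iff.mpr (by simpa using h)⟩,
        fun h0 => hx (congrArg Subtype.val h0), fun ⟨y, hy⟩ => ?_⟩
    have hy' : M.mulVec y = (μ k)⁻¹ • y := by
      simpa using Module.End.mem_eigenspace_iff.mp hy
    obtain ⟨c, hc⟩ := eigenvector_proportional hd hv (hvec h) hx (hvec hy')
    exact ⟨c, Subtype.ext hc⟩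
end

section
/- Let 0 < σ_1 < σ_2 < … < σ_m, let b_1, …, b_m > 0 with Σ_{j=1}^m b_j < 1, set b_{m+1} = 1 − Σ_{j=1}^m b_j, and let μ_1 < μ_2 < … < μ_m be the roots of equation (★). Consider the positive semidefinite quadratic form on ℝ^{m+1} defined by 𝓕(q) = Σ_{j=1}^m σ_j b_j (q_{m+1}/√b_{m+1} − q_j/√b_j)². Then there exists an orthonormal basis v_0, v_1, …, v_m of ℝ^{m+1} (with respect to the standard Euclidean inner product) with v_0 = (√b_1, √b_2, …, √b_{m+1}) such that 𝓕(x) = Σ_{k=1}^m μ_k ⟨x, v_k⟩² for all x ∈ ℝ^{m+1}; equivalently, the symmetric endomorphism of ℝ^{m+1} representing 𝓕 has eigenvalues 0, μ_1, …, μ_m, and its kernel is spanned by (√b_1, …, √b_{m+1}). -/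
open Finset

/-- The spectral theorem for symmetric endomorphisms of `Fin n → ℝ`, in coordinates. -/
theorem exists_eigenbasis_of_dotProduct_symm {n : ℕ} (T : (Fin n → ℝ) →ₗ[ℝ] (Fin n → ℝ))
    (hT : ∀ x y, T x ⬝ᵥ y = x ⬝ᵥ T y) :
    ∃ (e : Fin n → Fin n → ℝ) (l : Fin n → ℝ),
      (∀ i j, e i ⬝ᵥ e j = if i = j then (1 : ℝ) else 0) ∧
      (∀ i, T (e i) = l i • e i) ∧
      (∀ x, x ⬝ᵥ x = ∑ i, (x ⬝ᵥ e i) ^ 2) ∧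
      (∀ x, x ⬝ᵥ T x = ∑ i, l i * (x ⬝ᵥ e i) ^ 2) := by
  let L := WithLp.linearEquiv 2 ℝ (Fin n → ℝ)
  let S : EuclideanSpace ℝ (Fin n) →ₗ[ℝ] EuclideanSpace ℝ (Fin n) :=
    L.symm.toLinearMap ∘ₗ T ∘ₗ L.toLinearMap
  have inner_eq (x y : EuclideanSpace ℝ (Fin n)) : inner ℝ x y = L x ⬝ᵥ L y := by
    rw [EuclideanSpace.inner_eq_star_dotProduct, dotProduct_comm]
    simp [L]
  have hS : S.IsSymmetric := fun x y => by
    rw [inner_eq, inner_eq]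
    simpa [S] using hT (L x) (L y)
  have hn : Module.finrank ℝ (EuclideanSpace ℝ (Fin n)) = n := by simp
  let B := hS.eigenvectorBasis hn
  have hTB (i) : T (L (B i)) = hS.eigenvalues hn i • L (B i) :=
    congrArg L (hS.apply_eigenvectorBasis hn i)
  have parseval (x y : Fin n → ℝ) : x ⬝ᵥ y = ∑ i, (x ⬝ᵥ L (B i)) * (L (B i) ⬝ᵥ y) := by
    have h := B.sum_inner_mul_inner (L.symm x) (L.symm y)
    simpa [inner_eq] using h.symm
  refine ⟨fun i => L (B i), hS.eigenvalues hn, fun i j => ?_, hTB, fun x => ?_, fun x => ?_⟩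
  · rw [← inner_eq]
    exact orthonormal_iff_ite.mp B.orthonormal i j
  · rw [parseval]
    exact Finset.sum_congr rfl fun i _ => by rw [dotProduct_comm (L (B i)) x, sq]
  · rw [parseval]
    refine Finset.sum_congr rfl fun i _ => ?_
    rw [← hT, hTB, smul_dotProduct, dotProduct_comm (L (B i)) x, smul_eq_mul]
    ring

/-- The symmetric endomorphism representing the quadratic form
`x ↦ ∑ j, σ j * (s j * x_{m+1} / w - x j) ^ 2` on `ℝ^{m+1}`. -/
noncomputable def starEndomorphism {m : ℕ} (σ s : Fin m → ℝ) (w : ℝ) :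
    (Fin (m + 1) → ℝ) →ₗ[ℝ] (Fin (m + 1) → ℝ) where
  toFun x := Fin.snoc (fun j => σ j * (x j.castSucc - s j * x (Fin.last m) / w))
    (∑ j, σ j * (s j / w) * (s j * x (Fin.last m) / w - x j.castSucc))
  map_add' x y := by
    ext i
    refine Fin.lastCases ?_ (fun j => ?_) i
    · simp only [Fin.snoc_last, Pi.add_apply, ← Finset.sum_add_distrib]
      exact Finset.sum_congr rfl fun j _ => by ring
    · simp only [Fin.snoc_castSucc, Pi.add_apply]
      ring
  map_smul' c x := by
    ext i
    refine Fin.lastCases ?_ (fun j => ?_) i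
    · simp only [Fin.snoc_last, Pi.smul_apply, smul_eq_mul, RingHom.id_apply, Finset.mul_sum]
      exact Finset.sum_congr rfl fun j _ => by ring
    · simp only [Fin.snoc_castSucc, Pi.smul_apply, smul_eq_mul, RingHom.id_apply]
      ring

namespace starEndomorphism

variable {m : ℕ} {σ s : Fin m → ℝ} {w : ℝ}

theorem apply_castSucc (x : Fin (m + 1) → ℝ) (j : Fin m) :
    starEndomorphism σ s w x j.castSucc =
      σ j * (x j.castSucc - s j * x (Fin.last m) / w) := by
  simp [starEndomorphism]

theorem apply_last (x : Fin (m + 1) → ℝ) :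
    starEndomorphism σ s w x (Fin.last m) =
      ∑ j, σ j * (s j / w) * (s j * x (Fin.last m) / w - x j.castSucc) := by
  simp [starEndomorphism]

theorem dotProduct_apply (x y : Fin (m + 1) → ℝ) :
    x ⬝ᵥ starEndomorphism σ s w y = ∑ j, σ j * (s j * x (Fin.last m) / w - x j.castSucc) *
      (s j * y (Fin.last m) / w - y j.castSucc) := by
  simp only [dotProduct, Fin.sum_univ_castSucc, apply_castSucc, apply_last, Finset.mul_sum,
    ← Finset.sum_add_distrib]
  exact Finset.sum_congr rfl fun j _ => by ring

theorem symm (x y : Fin (m + 1) → ℝ) :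
    starEndomorphism σ s w x ⬝ᵥ y = x ⬝ᵥ starEndomorphism σ s w y := by
  rw [dotProduct_comm, dotProduct_apply, dotProduct_apply]
  exact Finset.sum_congr rfl fun j _ => by ring

theorem apply_snoc (hw : w ≠ 0) : starEndomorphism σ s w (Fin.snoc s w) = 0 := by
  ext i
  refine Fin.lastCases ?_ (fun j => ?_) i
  · simp [apply_last, hw]
  · simp [apply_castSucc, hw]

theorem eigen_castSucc {c : ℝ} {x : Fin (m + 1) → ℝ}
    (hx : starEndomorphism σ s w x = c • x) (j : Fin m) :
    (σ j - c) * x j.castSucc = σ j * s j * x (Fin.last m) / w := by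
  have h := congrFun hx j.castSucc
  rw [apply_castSucc, Pi.smul_apply, smul_eq_mul] at h
  linear_combination h

/-- Eigenvectors for a nonzero eigenvalue are orthogonal to the kernel vector. -/
theorem eigen_orthogonal (hw : w ≠ 0) {c : ℝ} (hc : c ≠ 0) {x : Fin (m + 1) → ℝ}
    (hx : starEndomorphism σ s w x = c • x) : Fin.snoc s w ⬝ᵥ x = 0 := by
  have h := symm (σ := σ) (s := s) (w := w) (Fin.snoc s w) x
  rw [apply_snoc hw, hx, zero_dotProduct, dotProduct_smul, smul_eq_mul] at h
  exact (mul_eq_zero.mp h.symm).resolve_left hc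

theorem eigen_sum (hw : w ≠ 0) {c : ℝ} (hc : c ≠ 0) {x : Fin (m + 1) → ℝ}
    (hx : starEndomorphism σ s w x = c • x) :
    ∑ j, s j * x j.castSucc + w * x (Fin.last m) = 0 := by
  simpa [dotProduct, Fin.sum_univ_castSucc] using eigen_orthogonal hw hc hx

theorem eigen_eq_zero (hσpos : ∀ i, 0 < σ i) (hσ : Function.Injective σ) (hs : ∀ i, s i ≠ 0)
    (hw : w ≠ 0) {c : ℝ} {x : Fin (m + 1) → ℝ} (hx : starEndomorphism σ s w x = c • x)
    (hlast : x (Fin.last m) = 0) : x = 0 := by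
  have hmul (j : Fin m) : (σ j - c) * x j.castSucc = 0 := by
    simpa [hlast] using eigen_castSucc hx j
  suffices h : ∀ j : Fin m, x j.castSucc = 0 by
    ext i
    exact Fin.lastCases hlast h i
  intro j
  by_contra hj
  have hcj : σ j = c := sub_eq_zero.mp ((mul_eq_zero.mp (hmul j)).resolve_right hj)
  have hsum := eigen_sum hw (hcj ▸ (hσpos j).ne') hx
  rw [hlast, mul_zero, add_zero, Finset.sum_eq_single j] at hsum
  · exact (mul_ne_zero (hs j) hj) hsum
  · intro i _ hij
    have : σ i - c ≠ 0 := sub_ne_zero.mpr fun h => hij (hσ (h.trans hcj.symm))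
    rw [(mul_eq_zero.mp (hmul i)).resolve_left this, mul_zero]
  · simp

theorem eigen_ne (hσpos : ∀ i, 0 < σ i) (hs : ∀ i, s i ≠ 0) (hw : w ≠ 0) {c : ℝ}
    {x : Fin (m + 1) → ℝ} (hx : starEndomorphism σ s w x = c • x)
    (hlast : x (Fin.last m) ≠ 0) (j : Fin m) : c ≠ σ j := by
  rintro rfl
  have h := eigen_castSucc hx j
  rw [sub_self, zero_mul] at h
  exact div_ne_zero (mul_ne_zero (mul_ne_zero (hσpos j).ne' (hs j)) hlast) hw h.symm

/-- Nonzero eigenvalues solve the secular equation. -/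
theorem eigen_secular (hσpos : ∀ i, 0 < σ i) (hs : ∀ i, s i ≠ 0) (hw : w ≠ 0) {c : ℝ}
    (hc : c ≠ 0) {x : Fin (m + 1) → ℝ} (hx : starEndomorphism σ s w x = c • x)
    (hlast : x (Fin.last m) ≠ 0) :
    1 + ∑ j, σ j * s j ^ 2 / (w ^ 2 * (σ j - c)) = 0 := by
  have hterm (j : Fin m) :
      s j * x j.castSucc = w * x (Fin.last m) * (σ j * s j ^ 2 / (w ^ 2 * (σ j - c))) := by
    have hne : σ j - c ≠ 0 := sub_ne_zero.mpr (eigen_ne hσpos hs hw hx hlast j).symm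
    have h := eigen_castSucc hx j
    field_simp at h ⊢
    linear_combination s j * h
  have hsum := eigen_sum hw hc hx
  simp_rw [hterm] at hsum
  rw [← Finset.mul_sum] at hsum
  refine (mul_eq_zero.mp ?_).resolve_left (mul_ne_zero hw hlast)
  linear_combination hsum

/-- Orthonormal eigenvectors have pairwise distinct eigenvalues. -/
theorem eigenvalues_injective (hσpos : ∀ i, 0 < σ i) (hσ : Function.Injective σ)
    (hs : ∀ i, s i ≠ 0) (hw : w ≠ 0) {ι : Type*} [DecidableEq ι] {e : ι → Fin (m + 1) → ℝ}
    {l : ι → ℝ} (he : ∀ i j, e i ⬝ᵥ e j = if i = j then (1 : ℝ) else 0)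
    (hl : ∀ i, starEndomorphism σ s w (e i) = l i • e i)
    (hlast : ∀ i, e i (Fin.last m) ≠ 0) : Function.Injective l := by
  intro i j hij
  by_contra hne
  have hx : starEndomorphism σ s w (e j (Fin.last m) • e i - e i (Fin.last m) • e j) =
      l i • (e j (Fin.last m) • e i - e i (Fin.last m) • e j) := by
    rw [map_sub, map_smul, map_smul, hl, hl, ← hij, smul_sub, smul_comm (l i), smul_comm (l i)]
  have h0 := eigen_eq_zero hσpos hσ hs hw hx (by simp [mul_comm])
  have h := congrArg (e i ⬝ᵥ ·) h0
  simp only [dotProduct_sub, dotProduct_smul, he, hne, dotProduct_zero] at h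
  exact hlast j (by simpa using h)

end starEndomorphism

/-- If the values of an injective `l` away from `i₀` all lie in
the range of `μ`, then `l` agrees with `μ` up to an enumeration. -/
theorem exists_enumeration_of_injective {m : ℕ} {l : Fin (m + 1) → ℝ} {μ : Fin m → ℝ}
    (hl : Function.Injective l) (i₀ : Fin (m + 1))
    (h : ∀ i, i ≠ i₀ → ∃ k, l i = μ k) :
    ∃ τ : Fin m → Fin (m + 1), Function.Injective τ ∧ (∀ k, τ k ≠ i₀) ∧ ∀ k, l (τ k) = μ k := by
  choose f hf using fun i : Fin m => h (i₀.succAbove i) (i₀.succAbove_ne i)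
  have hinj : Function.Injective f := fun a b hab =>
    Fin.succAbove_right_injective (hl (by rw [hf, hf, hab]))
  let g := Equiv.ofBijective f (Finite.injective_iff_bijective.mp hinj)
  refine ⟨fun k => i₀.succAbove (g.symm k), Fin.succAbove_right_injective.comp g.symm.injective,
    fun k => i₀.succAbove_ne _, fun k => ?_⟩
  rw [hf]
  exact congrArg μ (g.apply_symm_apply k)

/-- Let `0 < σ 0 < … < σ (m-1)`, `b i > 0` with `∑ i, b i < 1`, set
`b (m+1) = 1 - ∑ i, b i`, and let `μ 0 < … < μ (m-1)` be the roots of equation (★).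
Consider the quadratic form on `ℝ^{m+1}` given by
`𝓕(q) = ∑ j, σ j * b j * (q_{m+1}/√b_{m+1} - q_j/√(b j))²`. Then there is an
orthonormal basis `v 0, v 1, …, v m` of `ℝ^{m+1}` with
`v 0 = (√(b 1), …, √(b m), √(b_{m+1}))` such that
`𝓕(x) = ∑ k, μ k * ⟨x, v (k+1)⟩²` for all `x`. -/
theorem quadratic_form_diagonalization
    (m : ℕ) (hm : 1 ≤ m) (σ b μ : Fin m → ℝ)
    (hσpos : ∀ i, 0 < σ i) (hσmono : StrictMono σ)
    (hb : ∀ i, 0 < b i) (hbsum : ∑ i, b i < 1)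
    (hμmono : StrictMono μ)
    (hroots : ∀ z : ℝ, (∀ j, z ≠ σ j) →
      (1 + ∑ j, σ j * b j / ((1 - ∑ i, b i) * (σ j - z)) = 0 ↔ ∃ k, z = μ k)) :
    ∃ v : Fin (m + 1) → (Fin (m + 1) → ℝ),
      (∀ k l, ∑ i, v k i * v l i = if k = l then (1 : ℝ) else 0) ∧
      (v 0 = fun i => Real.sqrt ((Fin.snoc b (1 - ∑ j, b j) : Fin (m + 1) → ℝ) i)) ∧
      (∀ x : Fin (m + 1) → ℝ,
        ∑ j, σ j * b j * (x (Fin.last m) / Real.sqrt (1 - ∑ i, b i)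
            - x (Fin.castSucc j) / Real.sqrt (b j)) ^ 2
          = ∑ k : Fin m, μ k * (∑ i, x i * v (Fin.succ k) i) ^ 2) := by
  have hB : 0 < 1 - ∑ i, b i := sub_pos.mpr hbsum
  set w := √(1 - ∑ i, b i) with hw_def
  let s : Fin m → ℝ := fun j => √(b j)
  have hw : w ≠ 0 := (Real.sqrt_pos.mpr hB).ne'
  have hw2 : w ^ 2 = 1 - ∑ i, b i := Real.sq_sqrt hB.le
  have hs (j) : s j ≠ 0 := (Real.sqrt_pos.mpr (hb j)).ne'
  have hs2 (j) : s j ^ 2 = b j := Real.sq_sqrt (hb j).le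
  have hσ := hσmono.injective
  obtain ⟨e, l, he, hl, hnorm, hform⟩ :=
    exists_eigenbasis_of_dotProduct_symm (starEndomorphism σ s w) starEndomorphism.symm
  have hlast (i) : e i (Fin.last m) ≠ 0 := fun h0 => by
    have h := he i i
    rw [starEndomorphism.eigen_eq_zero hσpos hσ hs hw (hl i) h0] at h
    simp at h
  have hlinj := starEndomorphism.eigenvalues_injective hσpos hσ hs hw he hl hlast
  let u : Fin (m + 1) → ℝ := Fin.snoc s w
  have huu : u ⬝ᵥ u = 1 := by
    simp [u, dotProduct, Fin.sum_univ_castSucc, ← sq, hs2, hw2]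
  obtain ⟨i₀, hi₀⟩ : ∃ i, l i = 0 := by
    by_contra! hne
    refine one_ne_zero (huu.symm.trans ((hnorm u).trans (Finset.sum_eq_zero fun i _ => ?_)))
    rw [starEndomorphism.eigen_orthogonal hw (hne i) (hl i), sq, zero_mul]
  have hne (i) (hi : i ≠ i₀) : l i ≠ 0 := fun h => hi (hlinj (h.trans hi₀.symm))
  obtain ⟨τ, hτ, hτ₀, hlτ⟩ := exists_enumeration_of_injective (μ := μ) hlinj i₀ fun i hi => by
    refine (hroots _ (starEndomorphism.eigen_ne hσpos hs hw (hl i) (hlast i))).mp ?_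
    simpa only [hs2, hw2] using
      starEndomorphism.eigen_secular hσpos hs hw (hne i hi) (hl i) (hlast i)
  have hue (k) : u ⬝ᵥ e (τ k) = 0 :=
    starEndomorphism.eigen_orthogonal hw (hne _ (hτ₀ k)) (hl _)
  refine ⟨Fin.cons u (e ∘ τ), fun k k' => ?_, ?_, fun x => ?_⟩
  · change Fin.cons (α := fun _ => Fin (m + 1) → ℝ) u (e ∘ τ) k ⬝ᵥ
      Fin.cons (α := fun _ => Fin (m + 1) → ℝ) u (e ∘ τ) k' = _
    refine Fin.cases ?_ (fun k => ?_) k <;> refine Fin.cases ?_ (fun k' => ?_) k'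
    · simp [huu]
    · simp [hue, (Fin.succ_ne_zero k').symm]
    · simp [dotProduct_comm _ u, hue]
    · simp [he, hτ.eq_iff]
  · ext i
    refine Fin.lastCases ?_ (fun j => ?_) i <;> simp [u, s, hw_def]
  · have hbij : Function.Bijective (Fin.cons i₀ τ : Fin (m + 1) → Fin (m + 1)) :=
      Finite.injective_iff_bijective.mp
        (Fin.cons_injective_iff.mpr ⟨fun ⟨k, hk⟩ => hτ₀ k hk, hτ⟩)
    have h := hform x
    rw [starEndomorphism.dotProduct_apply, ← hbij.sum_comp, Fin.sum_univ_succ] at h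
    simp only [Fin.cons_zero, Fin.cons_succ, hi₀, zero_mul, zero_add, hlτ] at h
    refine Eq.trans (Finset.sum_congr rfl fun j _ => ?_) h
    change σ j * b j * (x (Fin.last m) / w - x j.castSucc / s j) ^ 2 = _
    have := hs j
    rw [← hs2]
    field_simp
end
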